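/- arXiv:1512.08679 — 10 statements merged into one kernel-verified Lean document; each statement's English description precedes it below -/
import Mathlib

section
/- For every power P > 0 and every pair of cross-channel gains (α₁, α₂) ∈ [0,1]², the two-player 2×2 game Γ₁ has at least one Nash equilibrium in pure strategies. -/
/-- `C x = (1/2) * log (1 + x)` (natural logarithm). -/
noncomputable def C (x : ℝ) : ℝ := (1/2) * Real.log (1 + x)

/-- `Λ₁(α₁,α₂)` for power `P`. -/
noncomputable def Lam1 (P a1 a2 : ℝ) : ℝ :=
  P ^ 2 * (a1 + a2) ^ 2 /
    (1 + (2 + a1 ^ 2 + a2 ^ 2) * P + (1 - a1 * a2) ^ 2 * P ^ 2)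

/-- Pure strategies of the game Γ₁. -/
inductive Strat where
  | FW : Strat
  | BW : Strat

/-- Payoff (secret key rate) of player 1 in the game Γ₁. -/
noncomputable def R1 (P a1 a2 : ℝ) : Strat → Strat → ℝ
  | Strat.FW, Strat.FW => C (P / (1 + a1 ^ 2 * P)) - C (a2 ^ 2 * P)
  | Strat.FW, Strat.BW => C (P / (1 + a1 ^ 2 * P)) - C (a2 ^ 2 * P / (1 + P))
  | Strat.BW, Strat.FW => C (P / (1 + a1 ^ 2 * P)) -
      C ((a1 ^ 2 * P + a2 ^ 2 * P ^ 2 + a1 ^ 2 * a2 ^ 2 * P ^ 2) / (1 + P + a2 ^ 2 * P))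
  | Strat.BW, Strat.BW => C (P / (1 + a1 ^ 2 * P)) - C (Lam1 P a1 a2)

/-- Payoff (secret key rate) of player 2 in the game Γ₁. -/
noncomputable def R2 (P a1 a2 : ℝ) : Strat → Strat → ℝ
  | Strat.FW, Strat.FW => C (P / (1 + a2 ^ 2 * P)) - C (a1 ^ 2 * P)
  | Strat.BW, Strat.FW => C (P / (1 + a2 ^ 2 * P)) - C (a1 ^ 2 * P / (1 + P))
  | Strat.FW, Strat.BW => C (P / (1 + a2 ^ 2 * P)) -
      C ((a2 ^ 2 * P + a1 ^ 2 * P ^ 2 + a1 ^ 2 * a2 ^ 2 * P ^ 2) / (1 + P + a1 ^ 2 * P))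
  | Strat.BW, Strat.BW => C (P / (1 + a2 ^ 2 * P)) - C (Lam1 P a1 a2)

/-- `(s1, s2)` is a Nash equilibrium of the game Γ₁. -/
def IsNE (P a1 a2 : ℝ) (s1 s2 : Strat) : Prop :=
  (∀ t1 : Strat, R1 P a1 a2 s1 s2 ≥ R1 P a1 a2 t1 s2) ∧
  (∀ t2 : Strat, R2 P a1 a2 s1 s2 ≥ R2 P a1 a2 s1 t2)

theorem C_le_C {x y : ℝ} (hx : 0 ≤ x) (hxy : x ≤ y) : C x ≤ C y := by
  unfold C
  have := Real.log_le_log (by linarith : 0 < 1 + x) (by linarith : 1 + x ≤ 1 + y)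
  linarith

theorem Lam1_nonneg {P a b : ℝ} (hP : 0 ≤ P) : 0 ≤ Lam1 P a b := by
  unfold Lam1
  positivity

/-- Against an opponent playing `FW`, playing `BW` leaks no more when `a ^ 2 ≤ b ^ 2`. -/
theorem le_leakage_of_sq_le {P a b : ℝ} (hP : 0 < P) (h : a ^ 2 ≤ b ^ 2) :
    (a ^ 2 * P + b ^ 2 * P ^ 2 + a ^ 2 * b ^ 2 * P ^ 2) / (1 + P + b ^ 2 * P) ≤ b ^ 2 * P := by
  rw [div_le_iff₀ (by positivity)]
  have : 0 ≤ (b ^ 2 - a ^ 2) * (P * (1 + b ^ 2 * P)) :=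
    mul_nonneg (by linarith) (by positivity)
  nlinarith

theorem Lam1_comm (P a b : ℝ) : Lam1 P a b = Lam1 P b a := by
  unfold Lam1
  ring_nf

theorem R1_swap (P a b : ℝ) (s t : Strat) : R1 P a b s t = R2 P b a t s := by
  cases s <;> cases t <;> simp only [R1, R2, Lam1_comm P a b, mul_comm (a ^ 2) (b ^ 2)]

theorem IsNE.swap {P a b : ℝ} {s t : Strat} (h : IsNE P a b s t) : IsNE P b a t s := by
  refine ⟨fun u => ?_, fun u => ?_⟩
  · simpa only [R1_swap] using h.2 u
  · simpa only [R1_swap] using h.1 u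

theorem exists_isNE_of_sq_le {P a b : ℝ} (hP : 0 < P) (h : a ^ 2 ≤ b ^ 2) :
    ∃ s t : Strat, IsNE P a b s t := by
  have hL := Lam1_nonneg (a := a) (b := b) hP.le
  rcases le_total (a ^ 2 * P / (1 + P)) (Lam1 P a b) with hc | hc
  · refine ⟨Strat.BW, Strat.FW, ?_, ?_⟩
    · rintro (_ | _)
      · exact sub_le_sub_left (C_le_C (by positivity) (le_leakage_of_sq_le hP h)) _
      · exact le_rfl
    · rintro (_ | _)
      · exact le_rfl
      · exact sub_le_sub_left (C_le_C (by positivity) hc) _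
  · have hab : a ^ 2 * P / (1 + P) ≤ b ^ 2 * P / (1 + P) := by gcongr
    refine ⟨Strat.BW, Strat.BW, ?_, ?_⟩
    · rintro (_ | _)
      · exact sub_le_sub_left (C_le_C hL (hc.trans hab)) _
      · exact le_rfl
    · rintro (_ | _)
      · exact sub_le_sub_left (C_le_C hL hc) _
      · exact le_rfl

/-- For every power `P > 0` and every `(α₁, α₂) ∈ [0,1]²`, the game Γ₁ has at least
one Nash equilibrium in pure strategies. -/
theorem stmt0 (P a1 a2 : ℝ) (hP : 0 < P)
    (h1 : a1 ∈ Set.Icc (0 : ℝ) 1) (h2 : a2 ∈ Set.Icc (0 : ℝ) 1) :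
    ∃ s1 s2 : Strat, IsNE P a1 a2 s1 s2 := by
  rcases le_total (a1 ^ 2) (a2 ^ 2) with h | h
  · exact exists_isNE_of_sq_le hP h
  · obtain ⟨s, t, hst⟩ := exists_isNE_of_sq_le hP h
    exact ⟨t, s, hst.swap⟩
end

section
/- If P > 1/2 and α₁ = α₂ = α for some α ∈ (0,1], then the set of Nash equilibria of the game Γ₁ is exactly {(FW,FW), (FW,BW), (BW,FW)}; in particular (BW,BW) is not a Nash equilibrium. -/
theorem C_lt_C {x y : ℝ} (hx : 0 ≤ x) (hxy : x < y) : C x < C y := by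
  have := Real.log_lt_log (by linarith : 0 < 1 + x) (by linarith : 1 + x < 1 + y)
  unfold C
  linarith

theorem div_one_add_lt_Lam1 {P a : ℝ} (hP : 1/2 < P) (ha : a ∈ Set.Ioc (0 : ℝ) 1) :
    a ^ 2 * P / (1 + P) < Lam1 P a a := by
  obtain ⟨h0, h1⟩ := ha
  have hP0 : 0 < P := by linarith
  have hb : a ^ 2 ≤ 1 := pow_le_one₀ h0.le h1
  have hD : 0 < 1 + (2 + a ^ 2 + a ^ 2) * P + (1 - a * a) ^ 2 * P ^ 2 := by positivity
  have key : 1 + (2 + a ^ 2 + a ^ 2) * P + (1 - a * a) ^ 2 * P ^ 2 < 4 * P * (1 + P) := by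
    have hc : 0 ≤ 1 - a ^ 2 := by linarith
    have hsq : (1 - a * a) ^ 2 ≤ 1 - a ^ 2 := by
      nlinarith [mul_nonneg hc (sq_nonneg a)]
    have h2 := mul_le_mul_of_nonneg_right hsq (sq_nonneg P)
    nlinarith [mul_nonneg hc hP0.le, mul_nonneg hc (sq_nonneg P),
      mul_pos (pow_pos h0 2) (mul_pos hP0 hP0)]
  unfold Lam1
  rw [div_lt_div_iff₀ (by linarith) hD]
  have := mul_lt_mul_of_pos_left key (by positivity : 0 < a ^ 2 * P)
  linarith

theorem leakage_BW_FW_of_eq {P a : ℝ} (hP : 0 < P) :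
    (a ^ 2 * P + a ^ 2 * P ^ 2 + a ^ 2 * a ^ 2 * P ^ 2) / (1 + P + a ^ 2 * P) = a ^ 2 * P := by
  have : 1 + P + a ^ 2 * P ≠ 0 := by positivity
  field_simp

/-- If `P > 1/2` and `α₁ = α₂ = α ∈ (0,1]`, then the set of Nash equilibria of Γ₁ is
exactly `{(FW,FW), (FW,BW), (BW,FW)}`; in particular `(BW,BW)` is not a NE. -/
theorem stmt1 (P a : ℝ) (hP : 1/2 < P) (ha : a ∈ Set.Ioc (0 : ℝ) 1) :
    {p : Strat × Strat | IsNE P a a p.1 p.2} =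
      ({(Strat.FW, Strat.FW), (Strat.FW, Strat.BW), (Strat.BW, Strat.FW)} :
        Set (Strat × Strat)) := by
  have hP0 : 0 < P := by linarith
  have hlt : C (a ^ 2 * P / (1 + P)) < C (Lam1 P a a) :=
    C_lt_C (by positivity) (div_one_add_lt_Lam1 hP ha)
  have forall_strat : ∀ p : Strat → Prop, (∀ t, p t) ↔ p Strat.FW ∧ p Strat.BW := fun p =>
    ⟨fun h => ⟨h _, h _⟩, fun h t => by cases t <;> simp [h]⟩
  ext ⟨s1, s2⟩
  cases s1 <;> cases s2 <;>
    simp [IsNE, R1, R2, forall_strat, leakage_BW_FW_of_eq hP0] <;> linarith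
end

section
/- If P > 1/2 and 0 ≤ α₂ < α₁ ≤ 1, then the game Γ₁ has a unique Nash equilibrium, namely (FW, BW). -/
/-- Against an opponent playing `FW`, the weaker incoming link leaks less under `FW`. -/
theorem leakage_FW_FW_lt_leakage_BW_FW {P a b : ℝ} (hP : 0 < P) (hb : 0 ≤ b) (hab : b < a) :
    b ^ 2 * P <
      (a ^ 2 * P + b ^ 2 * P ^ 2 + a ^ 2 * b ^ 2 * P ^ 2) / (1 + P + b ^ 2 * P) := by
  have hsq : b ^ 2 < a ^ 2 := by gcongr
  rw [lt_div_iff₀ (by positivity)]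
  have : 0 < P * (a ^ 2 - b ^ 2) * (1 + b ^ 2 * P) :=
    mul_pos (mul_pos hP (sub_pos.2 hsq)) (by positivity)
  linear_combination this

/-- Against an opponent playing `FW`, the stronger incoming link leaks less under `BW`. -/
theorem leakage_BW_FW_lt_leakage_FW_FW {P a b : ℝ} (hP : 0 < P) (hb : 0 ≤ b) (hab : b < a) :
    (b ^ 2 * P + a ^ 2 * P ^ 2 + a ^ 2 * b ^ 2 * P ^ 2) / (1 + P + a ^ 2 * P) <
      a ^ 2 * P := by
  have hsq : b ^ 2 < a ^ 2 := by gcongr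
  rw [div_lt_iff₀ (by positivity)]
  have : 0 < P * (a ^ 2 - b ^ 2) * (1 + a ^ 2 * P) :=
    mul_pos (mul_pos hP (sub_pos.2 hsq)) (by positivity)
  linear_combination this

/-- Against an opponent playing `BW`, the weaker incoming link leaks less under `FW`. -/
theorem leakage_FW_BW_lt_Lam1 {P a b : ℝ} (hP : 1 / 2 < P) (hb : 0 ≤ b) (hab : b < a)
    (ha : a ≤ 1) : b ^ 2 * P / (1 + P) < Lam1 P a b := by
  have hP0 : 0 < P := by linarith
  have hsq : b ^ 2 < a ^ 2 := by gcongr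
  have hb1 : b ^ 2 ≤ 1 := by nlinarith
  have hba : b ^ 2 ≤ a * b := by nlinarith
  have hab1 : a * b ≤ 1 := by nlinarith
  unfold Lam1
  rw [div_lt_div_iff₀ (by positivity) (by positivity)]
  have hcross : (1 - a * b) ^ 2 ≤ 1 - b ^ 2 := by nlinarith
  have hquad : b ^ 2 * P ^ 2 * (1 - a * b) ^ 2 ≤ b ^ 2 * P ^ 2 * (1 - b ^ 2) := by gcongr
  have hlin : 0 < (a ^ 2 - b ^ 2) * (P * (1 + P - b ^ 2)) :=
    mul_pos (sub_pos.2 hsq) (mul_pos hP0 (by linarith))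
  have hmixed : 0 ≤ (a * b - b ^ 2) * (P * (1 + P)) :=
    mul_nonneg (sub_nonneg.2 hba) (by positivity)
  have hdiag : 0 ≤ b ^ 2 *
      (4 * P * (1 + P) - (1 + 2 * P + 2 * b ^ 2 * P + (1 - b ^ 2) * P ^ 2)) := by
    refine mul_nonneg (sq_nonneg b) ?_
    nlinarith [mul_nonneg hP0.le (sub_nonneg.2 hb1), mul_nonneg (sq_nonneg P) (sq_nonneg b)]
  have key : b ^ 2 * (1 + (2 + a ^ 2 + b ^ 2) * P + (1 - a * b) ^ 2 * P ^ 2) <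
      P * (a + b) ^ 2 * (1 + P) := by
    linarith
  have := mul_lt_mul_of_pos_left key hP0
  linarith

/-- If `P > 1/2` and `0 ≤ α₂ < α₁ ≤ 1`, then the game Γ₁ has a unique Nash
equilibrium, namely `(FW, BW)`. -/
theorem stmt2 (P a1 a2 : ℝ) (hP : 1/2 < P)
    (h2 : 0 ≤ a2) (h21 : a2 < a1) (h1 : a1 ≤ 1) :
    ∀ s1 s2 : Strat, IsNE P a1 a2 s1 s2 ↔ (s1 = Strat.FW ∧ s2 = Strat.BW) := by
  have hP0 : 0 < P := by linarith
  have hFW : R1 P a1 a2 .BW .FW < R1 P a1 a2 .FW .FW :=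
    sub_lt_sub_left (C_lt_C (by positivity) (leakage_FW_FW_lt_leakage_BW_FW hP0 h2 h21)) _
  have hBW : R1 P a1 a2 .BW .BW < R1 P a1 a2 .FW .BW :=
    sub_lt_sub_left (C_lt_C (by positivity) (leakage_FW_BW_lt_Lam1 hP h2 h21 h1)) _
  have hR2 : R2 P a1 a2 .FW .FW < R2 P a1 a2 .FW .BW :=
    sub_lt_sub_left (C_lt_C (by positivity) (leakage_BW_FW_lt_leakage_FW_FW hP0 h2 h21)) _
  intro s1 s2
  constructor
  · rintro ⟨hs1, hs2⟩
    cases s1 <;> cases s2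
    · exact absurd (hs2 .BW) (not_le.2 hR2)
    · exact ⟨rfl, rfl⟩
    · exact absurd (hs1 .FW) (not_le.2 hFW)
    · exact absurd (hs1 .FW) (not_le.2 hBW)
  · rintro ⟨rfl, rfl⟩
    refine ⟨fun t1 => ?_, fun t2 => ?_⟩
    · cases t1
      exacts [le_rfl, hBW.le]
    · cases t2
      exacts [hR2.le, le_rfl]
end

section
/- Let Q₁, Q₂ > 0 and α₁, α₂ ∈ [0,1]. The strategy pair (FW, FW) is a Nash equilibrium of the general-power key-agreement game, i.e., both no-deviation inequalities C(α₂²Q₁) ≤ C((α₁²Q₂ + α₂²Q₁² + α₁²α₂²Q₁Q₂)/(1 + Q₁ + α₂²Q₁)) and C(α₁²Q₂) ≤ C((α₂²Q₁ + α₁²Q₂² + α₁²α₂²Q₁Q₂)/(1 + Q₂ + α₁²Q₂)) hold, if and only if α₂²Q₁ = α₁²Q₂. -/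
theorem C_le_C_iff {x y : ℝ} (hx : 0 ≤ x) (hy : 0 ≤ y) : C x ≤ C y ↔ x ≤ y := by
  unfold C
  rw [mul_le_mul_iff_right₀ (by norm_num), Real.log_le_log_iff (by positivity) (by positivity),
    add_le_add_iff_left]

/-- With received interference powers `u` and `v`, switching away from `FW` is not profitable
exactly when `u ≤ v`. -/
theorem C_le_C_leakage_iff {u v Q : ℝ} (hu : 0 ≤ u) (hv : 0 ≤ v) (hQ : 0 ≤ Q) :
    C u ≤ C ((v + u * Q + u * v) / (1 + Q + u)) ↔ u ≤ v := by
  rw [C_le_C_iff hu (by positivity), le_div_iff₀ (by positivity),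
    ← mul_le_mul_iff_left₀ (b := u) (c := v) (show 0 < 1 + u by positivity)]
  constructor <;> intro h <;> linarith

/-- For powers `Q₁, Q₂ > 0` and gains `α₁, α₂ ∈ [0,1]`, the pair `(FW, FW)` is a
Nash equilibrium of the general-power key-agreement game (i.e. the two
no-deviation inequalities hold) iff `α₂²Q₁ = α₁²Q₂`. -/
theorem stmt4 (Q1 Q2 a1 a2 : ℝ) (hQ1 : 0 < Q1) (hQ2 : 0 < Q2)
    (h1 : a1 ∈ Set.Icc (0 : ℝ) 1) (h2 : a2 ∈ Set.Icc (0 : ℝ) 1) :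
    (C (a2 ^ 2 * Q1) ≤
        C ((a1 ^ 2 * Q2 + a2 ^ 2 * Q1 ^ 2 + a1 ^ 2 * a2 ^ 2 * Q1 * Q2) /
            (1 + Q1 + a2 ^ 2 * Q1)) ∧
      C (a1 ^ 2 * Q2) ≤
        C ((a2 ^ 2 * Q1 + a1 ^ 2 * Q2 ^ 2 + a1 ^ 2 * a2 ^ 2 * Q1 * Q2) /
            (1 + Q2 + a1 ^ 2 * Q2))) ↔
      a2 ^ 2 * Q1 = a1 ^ 2 * Q2 := by
  have hu : 0 ≤ a2 ^ 2 * Q1 := by positivity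
  have hv : 0 ≤ a1 ^ 2 * Q2 := by positivity
  rw [le_antisymm_iff, ← C_le_C_leakage_iff hu hv hQ1.le, ← C_le_C_leakage_iff hv hu hQ2.le]
  ring_nf
end

section
/- Fix P > 0 and α₂ ∈ [0,1]. The function a ↦ Λ₁(a, α₂) = P²(a+α₂)²/(1 + (2 + a² + α₂²)P + (1 − aα₂)²P²) is strictly increasing on the interval [0,1]. -/
/-- For `P > 0` and `α₂ ∈ [0,1]`, the function `a ↦ Λ₁(a, α₂)` is strictly
increasing on `[0,1]`. -/
theorem stmt7 (P a2 : ℝ) (hP : 0 < P) (h2 : a2 ∈ Set.Icc (0 : ℝ) 1) :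
    StrictMonoOn (fun a : ℝ => Lam1 P a a2) (Set.Icc (0 : ℝ) 1) := by
  obtain ⟨hc0, hc1⟩ := h2
  have hden (a : ℝ) :
      0 < 1 + (2 + a ^ 2 + a2 ^ 2) * P + (1 - a * a2) ^ 2 * P ^ 2 := by positivity
  have hgap (a : ℝ) (ha : a ≤ 1) :
      0 < 1 + (1 + a2 ^ 2) * P - a2 * P * (a + a2) := by
    nlinarith [mul_nonneg hP.le (sub_nonneg.2 (mul_le_one₀ hc1 hc0 hc1)),
      mul_nonneg hP.le (mul_nonneg hc0 (sub_nonneg.2 ha)),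
      mul_nonneg hP.le (sub_nonneg.2 hc1)]
  rintro x ⟨hx0, hx1⟩ y ⟨hy0, hy1⟩ hxy
  have hM : 0 < 1 + (1 + a2 ^ 2) * P := by positivity
  have hs : 0 ≤ (x + a2) * (1 + (1 + a2 ^ 2) * P - a2 * P * (y + a2)) :=
    mul_nonneg (by linarith) (hgap y hy1).le
  have ht : 0 < (y + a2) * (1 + (1 + a2 ^ 2) * P - a2 * P * (x + a2)) :=
    mul_pos (by linarith) (hgap x hx1)
  have key := mul_pos (pow_pos hP 2)
    (mul_pos (mul_pos (sub_pos.2 hxy) hM) (add_pos_of_nonneg_of_pos hs ht))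
  simp only [Lam1]
  rw [div_lt_div_iff₀ (hden x) (hden y)]
  linear_combination key
end

section
/- If P > 1/2 and (α₁, α₂) ∈ [0,1]² with (α₁, α₂) ≠ (0,0), then Λ₁(α₁,α₂) > min(α₁², α₂²)·P/(1+P). (Consequently the strategy pair (BW,BW) is never a Nash equilibrium of the key-agreement game for such parameters.) -/
/-- The case of `Lam1` with ordered gains: increasing the larger gain only enlarges the gap, so
the bound follows from the diagonal case `a = b`. -/
theorem sq_mul_div_lt_Lam1 {P a b : ℝ} (hP : 1 / 2 < P) (ha : 0 ≤ a) (hab : a ≤ b) (hb : b ≤ 1)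
    (hb0 : 0 < b) : a ^ 2 * P / (1 + P) < Lam1 P a b := by
  have hP0 : 0 < P := by linarith
  unfold Lam1
  rw [div_lt_div_iff₀ (by positivity) (by positivity)]
  suffices h : a ^ 2 * (1 + (2 + a ^ 2 + b ^ 2) * P + (1 - a * b) ^ 2 * P ^ 2)
      < P * (1 + P) * (a + b) ^ 2 by
    have := mul_lt_mul_of_pos_left h hP0
    linarith
  rcases ha.eq_or_lt with rfl | ha0
  · have : 0 < P * (1 + P) * (0 + b) ^ 2 := by positivity
    simpa using this
  have ha2 : a ^ 2 ≤ 1 := pow_le_one₀ ha (hab.trans hb)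
  have hab1 : a * b ≤ 1 := mul_le_one₀ (hab.trans hb) hb0.le hb
  have hdiag : 1 + (2 + a ^ 2 + a ^ 2) * P + (1 - a ^ 2) ^ 2 * P ^ 2 < 4 * (P * (1 + P)) := by
    have hsq : (1 - a ^ 2) ^ 2 ≤ 1 - a ^ 2 := by nlinarith [sq_nonneg a]
    have hmul : (1 - a ^ 2) ^ 2 * P ^ 2 ≤ (1 - a ^ 2) * P ^ 2 := by gcongr
    nlinarith [mul_nonneg (sub_nonneg.2 ha2) hP0.le, mul_nonneg (sq_nonneg a) (sq_nonneg P)]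
  have hcross : (1 - a * b) ^ 2 ≤ (1 - a ^ 2) ^ 2 :=
    pow_le_pow_left₀ (by linarith) (by nlinarith) 2
  have hsum : a ^ 2 * (b ^ 2 - a ^ 2) ≤ (a + b) ^ 2 - 4 * a ^ 2 := by
    have : a ^ 2 * (b ^ 2 - a ^ 2) ≤ b ^ 2 - a ^ 2 :=
      mul_le_of_le_one_left (by nlinarith) ha2
    nlinarith
  have hdiff : 0 ≤ (a + b) ^ 2 - 4 * a ^ 2 := by nlinarith
  have hdiag' := mul_lt_mul_of_pos_left hdiag (pow_pos ha0 2)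
  have hcross' := mul_le_mul_of_nonneg_left hcross (by positivity : 0 ≤ a ^ 2 * P ^ 2)
  have hsum' := mul_le_mul_of_nonneg_left hsum hP0.le
  have hdiff' := mul_nonneg (sq_nonneg P) hdiff
  linarith

/-- If `P > 1/2` and `(α₁, α₂) ∈ [0,1]²` with `(α₁, α₂) ≠ (0,0)`, then
`Λ₁(α₁,α₂) > min(α₁², α₂²)·P/(1+P)`. -/
theorem stmt8 (P a1 a2 : ℝ) (hP : 1/2 < P)
    (h1 : a1 ∈ Set.Icc (0 : ℝ) 1) (h2 : a2 ∈ Set.Icc (0 : ℝ) 1)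
    (hne : (a1, a2) ≠ (0, 0)) :
    min (a1 ^ 2) (a2 ^ 2) * P / (1 + P) < Lam1 P a1 a2 := by
  obtain ⟨h1, h1'⟩ := h1
  obtain ⟨h2, h2'⟩ := h2
  rcases le_total a1 a2 with h | h
  · have h0 : 0 < a2 := h2.lt_of_ne' fun h0 => hne (by ext <;> simp <;> linarith)
    rw [min_eq_left (by gcongr)]
    exact sq_mul_div_lt_Lam1 hP h1 h h2' h0
  · have h0 : 0 < a1 := h1.lt_of_ne' fun h0 => hne (by ext <;> simp <;> linarith)
    rw [min_eq_right (by gcongr), Lam1_comm]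
    exact sq_mul_div_lt_Lam1 hP h2 h h1' h0
end

section
/- If P ≥ 1/2 and 0 ≤ α₂ ≤ α₁ ≤ 1, then α₂²·P/(1+P) ≤ Λ₁(α₁, α₂). -/
/-- If `P ≥ 1/2` and `0 ≤ α₂ ≤ α₁ ≤ 1`, then `α₂²·P/(1+P) ≤ Λ₁(α₁, α₂)`. -/
theorem stmt10 (P a1 a2 : ℝ) (hP : 1/2 ≤ P)
    (h2 : 0 ≤ a2) (h21 : a2 ≤ a1) (h1 : a1 ≤ 1) :
    a2 ^ 2 * P / (1 + P) ≤ Lam1 P a1 a2 := by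
  have hP0 : 0 < P := by linarith
  have ha1 : 0 ≤ a1 := h2.trans h21
  have hsq : a2 ^ 2 ≤ 1 := pow_le_one₀ h2 (h21.trans h1)
  have hmul : a1 * a2 ≤ 1 := mul_le_one₀ h1 h2 (h21.trans h1)
  -- The difference of the cross-multiplied sides is `a2 ^ 2` times this on the diagonal `a1 = a2`.
  have hdiag : 0 ≤ 2 * P * (1 - a2 ^ 2) + P ^ 2 * (4 - (1 - a2 ^ 2) ^ 2) - 1 := by
    have hconc : (1 - a2 ^ 2) ^ 2 ≤ 1 - a2 ^ 2 := by nlinarith [sq_nonneg a2]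
    nlinarith [mul_le_mul_of_nonneg_left hconc (sq_nonneg P),
      mul_nonneg (sub_nonneg.2 hsq) (show 0 ≤ 2 * P - P ^ 2 + 4 * P ^ 2 - 1 by nlinarith),
      mul_nonneg (sq_nonneg a2) (show 0 ≤ 4 * P ^ 2 - 1 by nlinarith)]
  -- The difference grows with `a1`: this is its divided difference between `a2` and `a1`.
  have hslope : 0 ≤ P * (1 + P) * (a1 + 3 * a2) - a2 ^ 2 * P * (a1 + a2)
      + a2 ^ 3 * P ^ 2 * (2 - a1 * a2 - a2 ^ 2) := by
    have hmain : a2 ^ 2 * (P * (a1 + a2)) ≤ P * (a1 + a2) :=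
      mul_le_of_le_one_left (by positivity) hsq
    have hrest : 0 ≤ a2 ^ 3 * P ^ 2 * (2 - a1 * a2 - a2 ^ 2) :=
      mul_nonneg (by positivity) (by linarith)
    have hquad : 0 ≤ P ^ 2 * (a1 + 3 * a2) := by positivity
    linarith [mul_nonneg hP0.le h2]
  have hpoly : a2 ^ 2 * (1 + (2 + a1 ^ 2 + a2 ^ 2) * P + (1 - a1 * a2) ^ 2 * P ^ 2)
      ≤ P * (1 + P) * (a1 + a2) ^ 2 := by
    linarith [mul_nonneg (sub_nonneg.2 h21) hslope, mul_nonneg (sq_nonneg a2) hdiag]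
  rw [Lam1, div_le_div_iff₀ (by positivity) (by positivity)]
  linarith [mul_le_mul_of_nonneg_left hpoly hP0.le]
end

section
/- For any powers P₁, P₂ > 0, gains α₁, α₂ ∈ [0,1], and fixed λ₂ ∈ [0,1], the function λ₁ ↦ A(λ₁, λ₂) is monotone on [0,1] (it is either monotonically nondecreasing on [0,1] or monotonically nonincreasing on [0,1]); in particular its maximum over λ₁ ∈ [0,1] is attained at λ₁ = 0 or λ₁ = 1. -/
/-- Forward-direction part of the secret key rate of the first BS-user pair under
the artificial-noise power-splitting scheme. -/
noncomputable def A (P1 P2 a1 a2 l1 l2 : ℝ) : ℝ :=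
  C ((1 - l1) * P1 / (1 + a1 ^ 2 * P2 + l1 * P1)) -
    C ((1 - l1) * a2 ^ 2 * P1 / (1 + a2 ^ 2 * l1 * P1 + l2 * P2))

/-- Backward-direction part of the secret key rate of the first BS-user pair under
the artificial-noise power-splitting scheme. -/
noncomputable def B (P1 P2 a1 a2 l1 l2 : ℝ) : ℝ :=
  C (((1 - a1 * a2) ^ 2 * l1 * l2 * P1 * P2 + a1 ^ 2 * l2 * P2 + l1 * P1) /
      (1 + a2 ^ 2 * l1 * P1 + l2 * P2)) -
    C (a1 ^ 2 * P2)

/-- Up to a constant, `λ₁ ↦ A(λ₁, λ₂)` is half the logarithm of a linear fractional function. -/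
lemma A_eq_log_div (P1 P2 a1 a2 l1 l2 : ℝ) (hP1 : 0 ≤ P1) (hP2 : 0 ≤ P2)
    (hl1 : 0 ≤ l1) (hl2 : 0 ≤ l2) :
    A P1 P2 a1 a2 l1 l2 =
      (1/2) * Real.log ((1 + a1 ^ 2 * P2 + P1) / (1 + a2 ^ 2 * P1 + l2 * P2)) +
        (1/2) * Real.log ((1 + a2 ^ 2 * l1 * P1 + l2 * P2) / (1 + a1 ^ 2 * P2 + l1 * P1)) := by
  have hu : 0 < 1 + a1 ^ 2 * P2 + l1 * P1 := by positivity
  have hv : 0 < 1 + a2 ^ 2 * l1 * P1 + l2 * P2 := by positivity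
  have hu1 : 0 < 1 + a1 ^ 2 * P2 + P1 := by positivity
  have hv1 : 0 < 1 + a2 ^ 2 * P1 + l2 * P2 := by positivity
  have e1 : 1 + (1 - l1) * P1 / (1 + a1 ^ 2 * P2 + l1 * P1) =
      (1 + a1 ^ 2 * P2 + P1) / (1 + a1 ^ 2 * P2 + l1 * P1) := by
    rw [eq_div_iff hu.ne', add_mul, div_mul_cancel₀ _ hu.ne']
    ring
  have e2 : 1 + (1 - l1) * a2 ^ 2 * P1 / (1 + a2 ^ 2 * l1 * P1 + l2 * P2) =
      (1 + a2 ^ 2 * P1 + l2 * P2) / (1 + a2 ^ 2 * l1 * P1 + l2 * P2) := by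
    rw [eq_div_iff hv.ne', add_mul, div_mul_cancel₀ _ hv.ne']
    ring
  rw [A, C, C, e1, e2, Real.log_div hu1.ne' hu.ne', Real.log_div hv1.ne' hv.ne',
    Real.log_div hu1.ne' hv1.ne', Real.log_div hv.ne' hu.ne']
  ring

/-- Comparing two values of `A(·, λ₂)` reduces to the sign of a product. -/
lemma A_le_A (P1 P2 a1 a2 x y l2 : ℝ) (hP1 : 0 ≤ P1) (hP2 : 0 ≤ P2)
    (hx : 0 ≤ x) (hy : 0 ≤ y) (hl2 : 0 ≤ l2)
    (h : 0 ≤ (y - x) * (a2 ^ 2 * (1 + a1 ^ 2 * P2) - (1 + l2 * P2))) :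
    A P1 P2 a1 a2 x l2 ≤ A P1 P2 a1 a2 y l2 := by
  rw [A_eq_log_div P1 P2 a1 a2 x l2 hP1 hP2 hx hl2, A_eq_log_div P1 P2 a1 a2 y l2 hP1 hP2 hy hl2]
  have hle : (1 + a2 ^ 2 * x * P1 + l2 * P2) / (1 + a1 ^ 2 * P2 + x * P1) ≤
      (1 + a2 ^ 2 * y * P1 + l2 * P2) / (1 + a1 ^ 2 * P2 + y * P1) := by
    rw [div_le_div_iff₀ (by positivity) (by positivity)]
    linarith [mul_nonneg hP1 h]
  have := Real.log_le_log (by positivity) hle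
  linarith

/-- For `P₁, P₂ > 0`, `α₁, α₂ ∈ [0,1]` and fixed `λ₂ ∈ [0,1]`, the function
`λ₁ ↦ A(λ₁, λ₂)` is monotone on `[0,1]`; in particular its maximum over
`λ₁ ∈ [0,1]` is attained at `λ₁ = 0` or `λ₁ = 1`. -/
theorem stmt13 (P1 P2 a1 a2 l2 : ℝ) (hP1 : 0 < P1) (hP2 : 0 < P2)
    (h1 : a1 ∈ Set.Icc (0 : ℝ) 1) (h2 : a2 ∈ Set.Icc (0 : ℝ) 1)
    (hl2 : l2 ∈ Set.Icc (0 : ℝ) 1) :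
    (MonotoneOn (fun l1 : ℝ => A P1 P2 a1 a2 l1 l2) (Set.Icc (0 : ℝ) 1) ∨
      AntitoneOn (fun l1 : ℝ => A P1 P2 a1 a2 l1 l2) (Set.Icc (0 : ℝ) 1)) ∧
    ∀ l1 ∈ Set.Icc (0 : ℝ) 1,
      A P1 P2 a1 a2 l1 l2 ≤ max (A P1 P2 a1 a2 0 l2) (A P1 P2 a1 a2 1 l2) := by
  have key : MonotoneOn (fun l1 : ℝ => A P1 P2 a1 a2 l1 l2) (Set.Icc (0 : ℝ) 1) ∨
      AntitoneOn (fun l1 : ℝ => A P1 P2 a1 a2 l1 l2) (Set.Icc (0 : ℝ) 1) := by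
    rcases le_total 0 (a2 ^ 2 * (1 + a1 ^ 2 * P2) - (1 + l2 * P2)) with h | h
    · exact Or.inl fun x hx y hy hxy => A_le_A P1 P2 a1 a2 x y l2 hP1.le hP2.le hx.1 hy.1 hl2.1
        (mul_nonneg (sub_nonneg.2 hxy) h)
    · exact Or.inr fun x hx y hy hxy => A_le_A P1 P2 a1 a2 y x l2 hP1.le hP2.le hy.1 hx.1 hl2.1
        (mul_nonneg_of_nonpos_of_nonpos (sub_nonpos.2 hxy) h)
  refine ⟨key, fun l1 hl => ?_⟩
  rcases key with h | h
  · exact le_max_of_le_right (h hl (Set.right_mem_Icc.2 zero_le_one) hl.2)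
  · exact le_max_of_le_left (h (Set.left_mem_Icc.2 zero_le_one) hl hl.1)
end

section
/- For any powers P₁, P₂ > 0, gains α₁, α₂ ∈ [0,1], and fixed λ₂ ∈ [0,1], the function λ₁ ↦ B(λ₁, λ₂) is monotone on [0,1] (it is either monotonically nondecreasing on [0,1] or monotonically nonincreasing on [0,1]); in particular its maximum over λ₁ ∈ [0,1] is attained at λ₁ = 0 or λ₁ = 1. -/
open Set

theorem C_monotoneOn : MonotoneOn C (Ici 0) := by
  intro x hx y _ hxy
  have hx' : 0 < 1 + x := by linarith [mem_Ici.1 hx]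
  have := Real.log_le_log hx' (by linarith : 1 + x ≤ 1 + y)
  unfold C
  linarith

/-- A linear fractional function with positive denominator is monotone or antitone
on the nonnegative half-line. -/
theorem monotoneOn_or_antitoneOn_linearFractional {p q r s : ℝ} (hr : 0 ≤ r) (hs : 0 < s) :
    MonotoneOn (fun x => (p * x + q) / (r * x + s)) (Ici 0) ∨
      AntitoneOn (fun x => (p * x + q) / (r * x + s)) (Ici 0) := by
  have hden {x : ℝ} (hx : x ∈ Ici 0) : 0 < r * x + s := by
    have := mul_nonneg hr (mem_Ici.1 hx)
    linarith
  refine (le_total (q * r) (p * s)).imp (fun h x hx y hy hxy => ?_) (fun h x hx y hy hxy => ?_)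
  · rw [div_le_div_iff₀ (hden hx) (hden hy)]
    linarith [mul_nonneg (sub_nonneg.2 h) (sub_nonneg.2 hxy)]
  · rw [div_le_div_iff₀ (hden hy) (hden hx)]
    linarith [mul_nonneg (sub_nonneg.2 h) (sub_nonneg.2 hxy)]

theorem B_monotoneOn_or_antitoneOn {P1 P2 a1 a2 l2 : ℝ} (hP1 : 0 ≤ P1) (hP2 : 0 ≤ P2)
    (hl2 : 0 ≤ l2) :
    MonotoneOn (fun l1 => B P1 P2 a1 a2 l1 l2) (Ici 0) ∨
      AntitoneOn (fun l1 => B P1 P2 a1 a2 l1 l2) (Ici 0) := by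
  set p := (1 - a1 * a2) ^ 2 * l2 * P1 * P2 + P1 with hp
  set q := a1 ^ 2 * l2 * P2 with hq
  set r := a2 ^ 2 * P1 with hr
  set s := 1 + l2 * P2 with hs
  have hp0 : 0 ≤ p := by positivity
  have hq0 : 0 ≤ q := by positivity
  have hr0 : 0 ≤ r := by positivity
  have hs0 : 0 < s := by positivity
  have hB (x : ℝ) : B P1 P2 a1 a2 x l2 = C ((p * x + q) / (r * x + s)) - C (a1 ^ 2 * P2) := by
    rw [B, hp, hq, hr, hs]
    congr 3 <;> ring
  have hmaps : MapsTo (fun x => (p * x + q) / (r * x + s)) (Ici 0) (Ici 0) := by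
    intro x hx
    have : 0 ≤ x := hx
    exact mem_Ici.2 (by positivity)
  simp only [hB]
  exact (monotoneOn_or_antitoneOn_linearFractional hr0 hs0).imp
    (fun h _ hx _ hy hxy => sub_le_sub_right (C_monotoneOn (hmaps hx) (hmaps hy) (h hx hy hxy)) _)
    (fun h _ hx _ hy hxy =>
      sub_le_sub_right (C_monotoneOn (hmaps hy) (hmaps hx) (h hx hy hxy)) _)

/-- For `P₁, P₂ > 0`, `α₁, α₂ ∈ [0,1]` and fixed `λ₂ ∈ [0,1]`, the function
`λ₁ ↦ B(λ₁, λ₂)` is monotone on `[0,1]`; in particular its maximum over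
`λ₁ ∈ [0,1]` is attained at `λ₁ = 0` or `λ₁ = 1`. -/
theorem stmt14 (P1 P2 a1 a2 l2 : ℝ) (hP1 : 0 < P1) (hP2 : 0 < P2)
    (h1 : a1 ∈ Set.Icc (0 : ℝ) 1) (h2 : a2 ∈ Set.Icc (0 : ℝ) 1)
    (hl2 : l2 ∈ Set.Icc (0 : ℝ) 1) :
    (MonotoneOn (fun l1 : ℝ => B P1 P2 a1 a2 l1 l2) (Set.Icc (0 : ℝ) 1) ∨
      AntitoneOn (fun l1 : ℝ => B P1 P2 a1 a2 l1 l2) (Set.Icc (0 : ℝ) 1)) ∧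
    ∀ l1 ∈ Set.Icc (0 : ℝ) 1,
      B P1 P2 a1 a2 l1 l2 ≤ max (B P1 P2 a1 a2 0 l2) (B P1 P2 a1 a2 1 l2) := by
  have hmono := (B_monotoneOn_or_antitoneOn (a1 := a1) (a2 := a2) hP1.le hP2.le hl2.1).imp
    (fun h => h.mono (Icc_subset_Ici_self : Icc (0 : ℝ) 1 ⊆ Ici 0))
    (fun h => h.mono (Icc_subset_Ici_self : Icc (0 : ℝ) 1 ⊆ Ici 0))
  refine ⟨hmono, fun l1 hl1 => ?_⟩
  rcases hmono with h | h
  · exact le_max_of_le_right (h hl1 (right_mem_Icc.2 zero_le_one) hl1.2)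
  · exact le_max_of_le_left (h (left_mem_Icc.2 zero_le_one) hl1 hl1.1)
end

section
/- For any powers P₁, P₂ > 0, gains α₁, α₂ ∈ [0,1], and fixed λ₂ ∈ [0,1], the function λ₁ ↦ A(λ₁, λ₂) + B(λ₁, λ₂) is monotone on [0,1] (either monotonically nondecreasing or monotonically nonincreasing on [0,1]); consequently, the best response of the first player in the artificial-noise game with payoff A + B is attained at λ₁ = 0 or λ₁ = 1, irrespective of λ₂. -/
/-- The logarithm of a ratio of positive affine functions is monotone or antitone. -/
theorem monotoneOn_or_antitoneOn_log_affine_sub {s : Set ℝ} {p q r t : ℝ}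
    (hN : ∀ x ∈ s, 0 < p + q * x) (hD : ∀ x ∈ s, 0 < r + t * x) :
    MonotoneOn (fun x => Real.log (p + q * x) - Real.log (r + t * x)) s ∨
      AntitoneOn (fun x => Real.log (p + q * x) - Real.log (r + t * x)) s := by
  have cross : ∀ x ∈ s, ∀ y ∈ s, (p + q * x) * (r + t * y) ≤ (p + q * y) * (r + t * x) →
      Real.log (p + q * x) - Real.log (r + t * x) ≤
        Real.log (p + q * y) - Real.log (r + t * y) := by
    intro x hx y hy h
    have hlog := Real.log_le_log (mul_pos (hN x hx) (hD y hy)) h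
    rw [Real.log_mul (hN x hx).ne' (hD y hy).ne',
      Real.log_mul (hN y hy).ne' (hD x hx).ne'] at hlog
    linarith
  rcases le_total (p * t) (q * r) with h | h
  · left
    intro x hx y hy hxy
    exact cross x hx y hy (by nlinarith [mul_nonneg (sub_nonneg.2 h) (sub_nonneg.2 hxy)])
  · right
    intro x hx y hy hxy
    exact cross y hy x hx (by nlinarith [mul_nonneg (sub_nonneg.2 h) (sub_nonneg.2 hxy)])

/-- A monotone or antitone function on `[a, b]` is bounded by its larger endpoint value. -/
theorem le_max_of_monotoneOn_or_antitoneOn_Icc {f : ℝ → ℝ} {a b x : ℝ}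
    (hf : MonotoneOn f (Set.Icc a b) ∨ AntitoneOn f (Set.Icc a b)) (hx : x ∈ Set.Icc a b) :
    f x ≤ max (f a) (f b) := by
  have hab := hx.1.trans hx.2
  rcases hf with hf | hf
  · exact le_max_of_le_right (hf hx (Set.right_mem_Icc.2 hab) hx.2)
  · exact le_max_of_le_left (hf (Set.left_mem_Icc.2 hab) hx hx.1)

theorem C_div {n d : ℝ} (hd : 0 < d) (hnd : 0 < d + n) :
    C (n / d) = 1 / 2 * (Real.log (d + n) - Real.log d) := by
  rw [C, one_add_div hd.ne', Real.log_div hnd.ne' hd.ne']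

/-- The secret key rate is, up to a constant, the logarithm of a ratio of affine functions
of the player's own splitting parameter. -/
theorem A_add_B_eq {P1 P2 a1 a2 l1 l2 : ℝ} (hP1 : 0 < P1) (hP2 : 0 < P2)
    (hl1 : 0 ≤ l1) (hl2 : 0 ≤ l2) :
    A P1 P2 a1 a2 l1 l2 + B P1 P2 a1 a2 l1 l2 =
      1 / 2 * (Real.log ((1 + l2 * P2 + a1 ^ 2 * l2 * P2) +
          (a2 ^ 2 * P1 + (1 - a1 * a2) ^ 2 * l2 * P1 * P2 + P1) * l1) -
        Real.log ((1 + a1 ^ 2 * P2) + P1 * l1)) +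
      (1 / 2 * (Real.log (1 + a1 ^ 2 * P2 + P1) - Real.log (1 + a2 ^ 2 * P1 + l2 * P2)) -
        C (a1 ^ 2 * P2)) := by
  have e1 : 1 + a1 ^ 2 * P2 + l1 * P1 + (1 - l1) * P1 = 1 + a1 ^ 2 * P2 + P1 := by ring
  have e2 : 1 + a2 ^ 2 * l1 * P1 + l2 * P2 + (1 - l1) * a2 ^ 2 * P1 =
      1 + a2 ^ 2 * P1 + l2 * P2 := by ring
  rw [A, B, C_div (by positivity) (by rw [e1]; positivity),
    C_div (by positivity) (by rw [e2]; positivity), C_div (by positivity) (by positivity), e1, e2]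
  ring_nf

/-- For `P₁, P₂ > 0`, `α₁, α₂ ∈ [0,1]` and fixed `λ₂ ∈ [0,1]`, the function
`λ₁ ↦ A(λ₁, λ₂) + B(λ₁, λ₂)` is monotone on `[0,1]`; consequently, the best
response of the first player in the artificial-noise game with payoff `A + B`
is attained at `λ₁ = 0` or `λ₁ = 1`, irrespective of `λ₂`. -/
theorem stmt15 (P1 P2 a1 a2 l2 : ℝ) (hP1 : 0 < P1) (hP2 : 0 < P2)
    (h1 : a1 ∈ Set.Icc (0 : ℝ) 1) (h2 : a2 ∈ Set.Icc (0 : ℝ) 1)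
    (hl2 : l2 ∈ Set.Icc (0 : ℝ) 1) :
    (MonotoneOn (fun l1 : ℝ => A P1 P2 a1 a2 l1 l2 + B P1 P2 a1 a2 l1 l2)
        (Set.Icc (0 : ℝ) 1) ∨
      AntitoneOn (fun l1 : ℝ => A P1 P2 a1 a2 l1 l2 + B P1 P2 a1 a2 l1 l2)
        (Set.Icc (0 : ℝ) 1)) ∧
    ∀ l1 ∈ Set.Icc (0 : ℝ) 1,
      A P1 P2 a1 a2 l1 l2 + B P1 P2 a1 a2 l1 l2 ≤
        max (A P1 P2 a1 a2 0 l2 + B P1 P2 a1 a2 0 l2)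
          (A P1 P2 a1 a2 1 l2 + B P1 P2 a1 a2 1 l2) := by
  have hmono : MonotoneOn (fun l1 : ℝ => A P1 P2 a1 a2 l1 l2 + B P1 P2 a1 a2 l1 l2)
        (Set.Icc (0 : ℝ) 1) ∨
      AntitoneOn (fun l1 : ℝ => A P1 P2 a1 a2 l1 l2 + B P1 P2 a1 a2 l1 l2)
        (Set.Icc (0 : ℝ) 1) := by
    have hv := hl2.1
    have key : ∀ l1 ∈ Set.Icc (0 : ℝ) 1, _ :=
      fun l1 hl1 => A_add_B_eq (a1 := a1) (a2 := a2) hP1 hP2 hl1.1 hv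
    refine (monotoneOn_or_antitoneOn_log_affine_sub (s := Set.Icc (0 : ℝ) 1)
      (p := 1 + l2 * P2 + a1 ^ 2 * l2 * P2)
      (q := a2 ^ 2 * P1 + (1 - a1 * a2) ^ 2 * l2 * P1 * P2 + P1)
      (r := 1 + a1 ^ 2 * P2) (t := P1) ?_ ?_).imp ?_ ?_
    · rintro x ⟨hx, -⟩
      positivity
    · rintro x ⟨hx, -⟩
      positivity
    all_goals
      intro h x hx y hy hxy
      have hle := h hx hy hxy
      simp only [key x hx, key y hy]
      simp only at hle
      linarith
  exact ⟨hmono, fun l1 hl1 => le_max_of_monotoneOn_or_antitoneOn_Icc hmono hl1⟩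
end
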